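/- For fixed z with ‖z‖ < R, the function g(x̂) := x̂ · ∇(∇Γ₀(Rx̂ − z)ᵀ p) restricted to the sphere of radius R lies in the closed span of the spherical harmonics of degree ≥ 1; in particular ∫_{𝕊²} g(x̂) ds = 0. -/

import Mathlib

open Real

local notation "E3" => EuclideanSpace ℝ (Fin 3)

/-- The fundamental solution of the Laplacian in ℝ³. -/
noncomputable def Gamma0 (x : E3) : ℝ := -1 / (4 * Real.pi * ‖x‖)

/-- The scalar function `x ↦ ∇Γ₀(x−z)ᵀ p`. -/
noncomputable def gradDot (z p : E3) (x : E3) : ℝ :=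
  ∑ j : Fin 3, fderiv ℝ Gamma0 (x - z) (EuclideanSpace.single j 1) * p j

/-- The vector field `f(x) = ∇(∇Γ₀(x−z)ᵀ p)`. -/
noncomputable def fField (z p : E3) (x : E3) : E3 :=
  (WithLp.equiv 2 (Fin 3 → ℝ)).symm fun i =>
    fderiv ℝ (gradDot z p) x (EuclideanSpace.single i 1)

open MeasureTheory

/-- Surface measure on the unit sphere. -/
noncomputable def sphereMeasure : Measure (Metric.sphere (0 : E3) 1) :=
  (volume : Measure E3).toSphere

open Metric NormedSpace
open scoped Pointwise

section Rotations

variable {E : Type*} [NormedAddCommGroup E] [InnerProductSpace ℝ E] [FiniteDimensional ℝ E]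
  [MeasurableSpace E] [BorelSpace E]

/-- The surface measure of the unit sphere is invariant under linear isometries. -/
theorem integral_toSphere_comp_linearIsometryEquiv (L : E ≃ₗᵢ[ℝ] E) (f : E → ℝ) :
    ∫ v : sphere (0 : E) 1, f (L v) ∂(volume : Measure E).toSphere =
      ∫ v : sphere (0 : E) 1, f v ∂(volume : Measure E).toSphere := by
  let S : sphere (0 : E) 1 ≃ₜ sphere (0 : E) 1 :=
    L.toHomeomorph.subtype fun x ↦ by simp
  have hS : MeasurePreserving S (volume : Measure E).toSphere (volume : Measure E).toSphere := by
    refine ⟨S.measurable, Measure.ext fun s hs ↦ ?_⟩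
    rw [Measure.map_apply S.measurable hs, Measure.toSphere_apply' _ (S.measurable hs),
      Measure.toSphere_apply' _ hs]
    have himage : Set.Ioo (0 : ℝ) 1 • ((↑) '' (S ⁻¹' s) : Set E) =
        L ⁻¹' (Set.Ioo (0 : ℝ) 1 • ((↑) '' s)) := by
      ext x
      simp only [Set.mem_smul, Set.mem_image, Set.mem_preimage]
      constructor
      · rintro ⟨r, hr, _, ⟨v, hv, rfl⟩, rfl⟩
        exact ⟨r, hr, S v, ⟨S v, hv, rfl⟩, (L.map_smul r v).symm⟩
      · rintro ⟨r, hr, _, ⟨v, hv, rfl⟩, h⟩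
        refine ⟨r, hr, S.symm v, ⟨S.symm v, by simpa using hv, rfl⟩, ?_⟩
        apply L.injective
        rw [L.map_smul, ← h]
        exact congrArg (fun y : sphere (0 : E) 1 ↦ r • (y : E)) (S.apply_symm_apply v)
    rw [himage, L.measurePreserving.measure_preimage_emb L.toHomeomorph.measurableEmbedding]
  exact hS.integral_comp S.measurableEmbedding (fun v : sphere (0 : E) 1 ↦ f v)

/-- The derivative of a function along an infinitesimal rotation has mean zero over spheres. -/
theorem integrable_and_integral_fderiv_skewAdjoint_eq_zero {J : E →L[ℝ] E}
    (hJ : J ∈ skewAdjoint (E →L[ℝ] E)) {u : E → ℝ} {U : Set E} (hU : IsOpen U)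
    (hu : ContDiffOn ℝ 1 u U) {R : ℝ} (hR : 0 ≤ R) (hsub : sphere (0 : E) R ⊆ U) :
    Integrable (fun v : sphere (0 : E) 1 ↦ fderiv ℝ u (R • (v : E)) (J (R • (v : E))))
        (volume : Measure E).toSphere ∧
      ∫ v : sphere (0 : E) 1, fderiv ℝ u (R • (v : E)) (J (R • (v : E)))
        ∂(volume : Measure E).toSphere = 0 := by
  let : NormedAlgebra ℚ (E →L[ℝ] E) := NormedAlgebra.restrictScalars ℚ ℝ _
  have hunitary (t : ℝ) : exp (t • J) ∈ unitary (E →L[ℝ] E) :=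
    exp_mem_unitary_of_mem_skewAdjoint (skewAdjoint.smul_mem t hJ)
  let L (t : ℝ) : E ≃ₗᵢ[ℝ] E := Unitary.linearIsometryEquiv ⟨_, hunitary t⟩
  have hL (t : ℝ) (x : E) : L t x = exp (t • J) x := rfl
  have hmem (t : ℝ) (v : sphere (0 : E) 1) : R • L t v ∈ sphere (0 : E) R := by
    simp [norm_smul, abs_of_nonneg hR]
  have hcont : ContinuousOn (fderiv ℝ u) (sphere (0 : E) R) :=
    (hu.continuousOn_fderiv_of_isOpen hU le_rfl).mono hsub
  obtain ⟨M, hM⟩ := (isCompact_sphere (0 : E) R).exists_bound_of_continuousOn hcont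
  have key := hasDerivAt_integral_of_dominated_loc_of_deriv_le
    (μ := (volume : Measure E).toSphere) (x₀ := (0 : ℝ)) (s := Set.univ)
    (F := fun t (v : sphere (0 : E) 1) ↦ u (R • L t v))
    (F' := fun t (v : sphere (0 : E) 1) ↦ fderiv ℝ u (R • L t v) (R • J (L t v)))
    (bound := fun _ ↦ M * (R * ‖J‖)) Filter.univ_mem
    (.of_forall fun t ↦ Continuous.aestronglyMeasurable <|
      hu.continuousOn.comp_continuous (by fun_prop) fun v ↦ hsub (hmem t v))
    (Continuous.integrable_of_hasCompactSupport
      (hu.continuousOn.comp_continuous (by fun_prop) fun v ↦ hsub (hmem 0 v))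
      (HasCompactSupport.of_compactSpace _))
    (Continuous.aestronglyMeasurable <|
      (hcont.comp_continuous (by fun_prop) fun v ↦ hmem 0 v).clm_apply (by fun_prop))
    (.of_forall fun v t _ ↦ by
      refine (ContinuousLinearMap.le_opNorm _ _).trans ?_
      gcongr
      · exact (norm_nonneg _).trans (hM _ (hmem t v))
      · exact hM _ (hmem t v)
      · rw [norm_smul, Real.norm_of_nonneg hR]
        gcongr
        simpa using J.le_opNorm (L t v))
    (integrable_const _)
    (.of_forall fun v t _ ↦ by
      have h1 : HasDerivAt (fun t : ℝ ↦ R • L t v) (R • J (L t v)) t :=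
        ((hasDerivAt_exp_smul_const' (𝕂 := ℝ) J t).clm_apply
          (hasDerivAt_const t (v : E))).const_smul R |>.congr_deriv (by simp [hL])
      exact ((hu.differentiableOn one_ne_zero).differentiableAt
        (hU.mem_nhds (hsub (hmem t v)))).hasFDerivAt.comp_hasDerivAt t h1)
  have hL0 (x : E) : L 0 x = x := by simp [hL]
  simp only [hL0, ← J.map_smul] at key
  refine ⟨key.1, ?_⟩
  have hconst (t : ℝ) : ∫ v : sphere (0 : E) 1, u (R • L t v) ∂(volume : Measure E).toSphere =
      ∫ v : sphere (0 : E) 1, u (R • (v : E)) ∂(volume : Measure E).toSphere :=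
    integral_toSphere_comp_linearIsometryEquiv (L t) fun x ↦ u (R • x)
  exact key.2.unique ((hasDerivAt_const _ _).congr_of_eventuallyEq (.of_forall hconst))

end Rotations

section Dipole

variable {E : Type*} [NormedAddCommGroup E] [InnerProductSpace ℝ E]

theorem hasFDerivAt_inv_norm_pow {x : E} (hx : x ≠ 0) (n : ℕ) :
    HasFDerivAt (fun y : E ↦ (‖y‖ ^ n)⁻¹) ((-n * (‖x‖ ^ (n + 2))⁻¹) • innerSL ℝ x) x := by
  have hn : ‖x‖ ≠ 0 := norm_ne_zero_iff.2 hx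
  have hnorm : HasFDerivAt (fun y : E ↦ ‖y‖) (‖x‖⁻¹ • innerSL ℝ x) x := by
    have h := (hasStrictFDerivAt_norm_sq x).hasFDerivAt.sqrt (pow_ne_zero 2 hn)
    simp only [Real.sqrt_sq (norm_nonneg _)] at h
    refine h.congr_fderiv ?_
    ext v
    simp
    field_simp
  refine ((hasDerivAt_pow n ‖x‖).fun_inv (pow_ne_zero n hn)).comp_hasFDerivAt x hnorm
    |>.congr_fderiv ?_
  rcases n with _ | n
  · simp
  ext v
  simp
  field_simp
  ring

/-- Up to the factor `4 * π`, the electrostatic potential of a dipole with moment `a` at `z`. -/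
noncomputable def dipole (a z x : E) : ℝ := inner ℝ a (x - z) * (‖x - z‖ ^ 3)⁻¹

theorem hasFDerivAt_dipole (a : E) {z x : E} (hx : x ≠ z) :
    HasFDerivAt (dipole a z) ((‖x - z‖ ^ 3)⁻¹ • innerSL ℝ a -
      (3 * inner ℝ a (x - z) * (‖x - z‖ ^ 5)⁻¹) • innerSL ℝ (x - z)) x := by
  have hsub : HasFDerivAt (fun y : E ↦ y - z) (ContinuousLinearMap.id ℝ E) x :=
    (hasFDerivAt_id x).sub_const z
  have h1 := ((innerSL ℝ a).hasFDerivAt (x := x - z)).comp x hsub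
  have h2 := (hasFDerivAt_inv_norm_pow (sub_ne_zero.2 hx) 3).comp x hsub
  refine (h1.mul h2).congr_fderiv ?_
  ext v
  simp
  ring

theorem contDiffOn_dipole (a z : E) : ContDiffOn ℝ 1 (dipole a z) {z}ᶜ := by
  intro x hx
  have hx' : x - z ≠ 0 := sub_ne_zero.2 hx
  have hsub : ContDiffAt ℝ 1 (fun y : E ↦ y - z) x := by fun_prop
  have hnorm : ContDiffAt ℝ 1 (fun y : E ↦ ‖y - z‖) x := hsub.norm ℝ hx'
  exact ((contDiffAt_const.inner ℝ hsub).mul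
    ((hnorm.pow 3).inv (pow_ne_zero 3 (norm_ne_zero_iff.2 hx')))).contDiffWithinAt

end Dipole

theorem hasFDerivAt_Gamma0 {x : E3} (hx : x ≠ 0) :
    HasFDerivAt Gamma0 ((4 * π * ‖x‖ ^ 3)⁻¹ • innerSL ℝ x) x := by
  have h := (hasFDerivAt_inv_norm_pow hx 1).const_mul (-(4 * π)⁻¹)
  have heq : Gamma0 = fun y : E3 ↦ -(4 * π)⁻¹ * (‖y‖ ^ 1)⁻¹ := by
    ext y
    simp [Gamma0, div_eq_mul_inv, mul_comm]
  rw [heq]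
  refine h.congr_fderiv ?_
  ext v
  simp
  ring

theorem gradDot_eq_dipole (p : E3) {z x : E3} (hx : x ≠ z) :
    gradDot z p x = (4 * π)⁻¹ * dipole p z x := by
  simp only [gradDot, dipole, (hasFDerivAt_Gamma0 (sub_ne_zero.2 hx)).fderiv,
    PiLp.inner_apply, Fin.sum_univ_three]
  simp [EuclideanSpace.inner_single_right]
  ring

/-- The infinitesimal rotation in the plane of the `i`-th and `j`-th coordinates. -/
noncomputable def planeRotation (i j : Fin 3) : E3 →L[ℝ] E3 :=
  (EuclideanSpace.proj i : E3 →L[ℝ] ℝ).smulRight (EuclideanSpace.single j 1) -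
    (EuclideanSpace.proj j : E3 →L[ℝ] ℝ).smulRight (EuclideanSpace.single i 1)

theorem planeRotation_mem_skewAdjoint (i j : Fin 3) :
    planeRotation i j ∈ skewAdjoint (E3 →L[ℝ] E3) := by
  rw [skewAdjoint.mem_iff, ContinuousLinearMap.star_eq_adjoint]
  symm
  rw [ContinuousLinearMap.eq_adjoint_iff]
  intro x y
  simp [planeRotation, inner_sub_left, inner_sub_right, real_inner_smul_left,
    real_inner_smul_right, EuclideanSpace.inner_single_right, EuclideanSpace.inner_single_left]
  ring

/-- Away from its source, the field of a dipole is a curl: its radial component is a sum of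
derivatives along infinitesimal rotations. -/
theorem fderiv_dipole_eq_neg_sum_planeRotation (p v : E3) {z x : E3} (hx : x ≠ z) :
    fderiv ℝ (dipole p z) x v =
      -(fderiv ℝ (dipole (planeRotation 0 1 p) z) x (planeRotation 0 1 v) +
        fderiv ℝ (dipole (planeRotation 1 2 p) z) x (planeRotation 1 2 v) +
        fderiv ℝ (dipole (planeRotation 2 0 p) z) x (planeRotation 2 0 v)) := by
  have hn : ‖x - z‖ ≠ 0 := norm_ne_zero_iff.2 (sub_ne_zero.2 hx)
  have hsq : ‖x - z‖ ^ 2 = (x 0 - z 0) ^ 2 + (x 1 - z 1) ^ 2 + (x 2 - z 2) ^ 2 := by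
    simp [EuclideanSpace.norm_sq_eq, Fin.sum_univ_three]
  have h3 : (‖x - z‖ ^ 3)⁻¹ = ‖x - z‖ ^ 2 * (‖x - z‖ ^ 5)⁻¹ := by field_simp
  simp only [(hasFDerivAt_dipole _ hx).fderiv, h3, hsq]
  simp [planeRotation, PiLp.inner_apply, Fin.sum_univ_three]
  ring

theorem sum_mul_fField (p v : E3) {z x : E3} (hx : x ≠ z) :
    ∑ i, v i * fField z p x i = (4 * π)⁻¹ * fderiv ℝ (dipole p z) x v := by
  have heq : gradDot z p =ᶠ[nhds x] fun y ↦ (4 * π)⁻¹ * dipole p z y :=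
    (isOpen_compl_singleton.eventually_mem hx).mono fun y hy ↦ gradDot_eq_dipole p hy
  have hd : fderiv ℝ (gradDot z p) x = (4 * π)⁻¹ • fderiv ℝ (dipole p z) x := by
    rw [heq.fderiv_eq, fderiv_const_mul (hasFDerivAt_dipole p hx).differentiableAt]
  have hv : v = ∑ i, v i • EuclideanSpace.single i (1 : ℝ) := by
    ext k
    simp [Finset.sum_apply, Pi.single_apply]
  conv_rhs => rw [hv]
  simp only [fField, hd, map_sum, map_smul, Finset.mul_sum]
  refine Finset.sum_congr rfl fun i _ ↦ ?_
  simp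
  ring

/-- For `‖z‖ < R`, the function `g(x̂) = x̂ · ∇(∇Γ₀(Rx̂−z)ᵀ p)` on the unit
sphere is orthogonal to the constants: `∫_{𝕊²} g(x̂) ds = 0` (it lies in the
closed span of the spherical harmonics of degree ≥ 1). -/
theorem radial_derivative_mean_zero (z p : E3) (R : ℝ) (hR : 0 < R) (hz : ‖z‖ < R) :
    ∫ v : Metric.sphere (0 : E3) 1,
        (∑ i : Fin 3, (v : E3) i * fField z p (R • (v : E3)) i) ∂sphereMeasure = 0 := by
  have hne (v : sphere (0 : E3) 1) : R • (v : E3) ≠ z := by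
    rintro rfl
    simp [norm_smul, abs_of_pos hR] at hz
  have hsub : sphere (0 : E3) R ⊆ {z}ᶜ := by
    rintro x hx rfl
    exact hz.ne (mem_sphere_zero_iff_norm.1 hx)
  have hrot (i j : Fin 3) := integrable_and_integral_fderiv_skewAdjoint_eq_zero
    (planeRotation_mem_skewAdjoint i j) isOpen_compl_singleton
    (contDiffOn_dipole (planeRotation i j p) z) hR.le hsub
  have hpoint (v : sphere (0 : E3) 1) :
      ∑ i : Fin 3, (v : E3) i * fField z p (R • (v : E3)) i =
        -((4 * π)⁻¹ * R⁻¹) *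
        (fderiv ℝ (dipole (planeRotation 0 1 p) z) (R • (v : E3)) (planeRotation 0 1 (R • v)) +
        fderiv ℝ (dipole (planeRotation 1 2 p) z) (R • (v : E3)) (planeRotation 1 2 (R • v)) +
        fderiv ℝ (dipole (planeRotation 2 0 p) z) (R • (v : E3))
          (planeRotation 2 0 (R • v))) := by
    rw [sum_mul_fField p v (hne v), fderiv_dipole_eq_neg_sum_planeRotation p v (hne v)]
    simp only [map_smul, smul_eq_mul]
    field_simp
  simp only [hpoint, sphereMeasure]
  rw [integral_const_mul, integral_add ((hrot 0 1).1.fun_add (hrot 1 2).1) (hrot 2 0).1,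
    integral_add (hrot 0 1).1 (hrot 1 2).1, (hrot 0 1).2, (hrot 1 2).2, (hrot 2 0).2]
  simp
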